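/- Under the PolyCD algorithm with exact line-search steps on a polytope S = conv{v^1,…,v^M} with diameter D, for f convex and L-smooth on S, the outer iterates satisfy f(x^t) - f* ≤ max{f(x^1) - f*, 4MLD²}/t for all t ≥ 1. -/

import Mathlib

open scoped RealInnerProductSpace

section aux

variable {E : Type*} [NormedAddCommGroup E] [InnerProductSpace ℝ E] [CompleteSpace E]

lemma aux_line {f : E → ℝ} {a w G : E} {s : ℝ} (h : HasGradientAt f G (a + s • w)) :
    HasDerivAt (fun s : ℝ => f (a + s • w)) ⟪G, w⟫ s := by
  have h1 : HasDerivAt (fun s : ℝ => a + s • w) w s := by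
    simpa using ((hasDerivAt_id s).smul_const w).const_add a
  have h2 := h.hasFDerivAt.comp_hasDerivAt s h1
  rw [InnerProductSpace.toDual_apply_apply] at h2
  exact h2

lemma aux_slope {φ : ℝ → ℝ} {m c : ℝ} (h : HasDerivAt φ m 0)
    (hc : ∀ s ∈ Set.Ioc (0 : ℝ) 1, φ 0 + s * c ≤ φ s) : c ≤ m := by
  have h1 := h.tendsto_slope_zero_right
  refine ge_of_tendsto h1 ?_
  have : Set.Ioc (0 : ℝ) 1 ∈ nhdsWithin (0 : ℝ) (Set.Ioi 0) := Ioc_mem_nhdsGT one_pos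
  filter_upwards [this] with s hs
  have := hc s hs
  rw [zero_add, smul_eq_mul, inv_mul_eq_div, le_div_iff₀ hs.1]
  linarith

lemma aux_mem {S : Set E} (hS : Convex ℝ S) {a z : E} (ha : a ∈ S) (hz : z ∈ S) {s : ℝ}
    (hs : s ∈ Set.Icc (0 : ℝ) 1) : a + s • (z - a) ∈ S :=
  hS.add_smul_sub_mem ha hz hs

lemma aux_descent {S : Set E} (hS : Convex ℝ S) {f : E → ℝ} {g : E → E} {L : ℝ}
    (hgrad : ∀ y ∈ S, HasGradientAt f (g y) y)
    (hlip : ∀ a ∈ S, ∀ b ∈ S, ‖g a - g b‖ ≤ L * ‖a - b‖) {a z : E} (ha : a ∈ S) (hz : z ∈ S) :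
    f z ≤ f a + ⟪g a, z - a⟫ + L / 2 * ‖z - a‖ ^ 2 := by
  set w := z - a with hw
  have hd : ∀ s ∈ Set.Icc (0 : ℝ) 1, HasDerivAt
      (fun s : ℝ => f (a + s • w) - (s * ⟪g a, w⟫ + s ^ 2 * (L / 2 * ‖w‖ ^ 2)))
      (⟪g (a + s • w), w⟫ - (⟪g a, w⟫ + 2 * s * (L / 2 * ‖w‖ ^ 2))) s := by
    intro s hs
    have h1 := aux_line (hgrad _ (aux_mem hS ha hz hs))
    have h2 : HasDerivAt (fun s : ℝ => s * ⟪g a, w⟫ + s ^ 2 * (L / 2 * ‖w‖ ^ 2))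
        (⟪g a, w⟫ + 2 * s * (L / 2 * ‖w‖ ^ 2)) s := by
      have h3 := (hasDerivAt_id s).mul_const ⟪g a, w⟫
      have h4 := (hasDerivAt_pow 2 s).mul_const (L / 2 * ‖w‖ ^ 2)
      have := h3.add h4
      refine this.congr_deriv ?_
      norm_num
    exact h1.sub h2
  have hanti : AntitoneOn
      (fun s : ℝ => f (a + s • w) - (s * ⟪g a, w⟫ + s ^ 2 * (L / 2 * ‖w‖ ^ 2)))
      (Set.Icc 0 1) := by
    apply antitoneOn_of_deriv_nonpos (convex_Icc 0 1)
    · intro s hs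
      exact (hd s hs).continuousAt.continuousWithinAt
    · intro s hs
      exact (hd s (interior_subset hs)).differentiableAt.differentiableWithinAt
    · intro s hs
      have hs' := interior_subset hs
      rw [(hd s hs').deriv]
      have h1 : ⟪g (a + s • w) - g a, w⟫ ≤ ‖g (a + s • w) - g a‖ * ‖w‖ := real_inner_le_norm _ _
      have h2 := hlip _ (aux_mem hS ha hz hs') a ha
      rw [inner_sub_left] at h1
      have h3 : ‖a + s • w - a‖ = s * ‖w‖ := by
        rw [add_sub_cancel_left, norm_smul, Real.norm_of_nonneg hs'.1]
      rw [← hw, h3] at h2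
      have h4 := mul_le_mul_of_nonneg_right h2 (norm_nonneg w)
      nlinarith
  have := hanti (Set.left_mem_Icc.2 zero_le_one) (Set.right_mem_Icc.2 zero_le_one) zero_le_one
  simp only [one_smul, zero_smul, add_zero] at this
  rw [show a + w = z by simp [hw]] at this
  norm_num at this
  linarith

lemma aux_convex {S : Set E} {f : E → ℝ} {G : E} (hconv : ConvexOn ℝ S f) {a z : E}
    (ha : a ∈ S) (hz : z ∈ S) (hg : HasGradientAt f G a) :
    f a + ⟪G, z - a⟫ ≤ f z := by
  have h0 : HasGradientAt f G (a + (0 : ℝ) • (z - a)) := by simpa using hg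
  have h1 := (aux_line h0).neg
  have := aux_slope (c := f a - f z) h1 (by
    intro s hs
    have := hconv.2 ha hz (sub_nonneg.2 hs.2) hs.1.le (by ring)
    rw [show (1 - s) • a + s • z = a + s • (z - a) by module] at this
    simp only [smul_eq_mul] at this
    simp
    linarith)
  linarith

lemma aux_opt {f : E → ℝ} {G b w : E} (hg : HasGradientAt f G b)
    (h : ∀ s ∈ Set.Ioc (0 : ℝ) 1, f b ≤ f (b + s • w)) : 0 ≤ ⟪G, w⟫ := by
  have h0 : HasGradientAt f G (b + (0 : ℝ) • w) := by simpa using hg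
  exact aux_slope (aux_line h0) (by intro s hs; simpa using h s hs)

lemma aux_step {S : Set E} (hS : Convex ℝ S) {f : E → ℝ} {g : E → E} {L D : ℝ} (hL : 0 < L)
    (hD : ∀ a ∈ S, ∀ b ∈ S, ‖a - b‖ ≤ D) (hconv : ConvexOn ℝ S f)
    (hgrad : ∀ y ∈ S, HasGradientAt f (g y) y)
    (hlip : ∀ a ∈ S, ∀ b ∈ S, ‖g a - g b‖ ≤ L * ‖a - b‖) {a b u : E} (ha : a ∈ S) (hb : b ∈ S)
    (hu : u ∈ S) :
    ⟪g a, a - u⟫ - ⟪g b, b - u⟫ ≤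
      √(2 * L * D ^ 2 * (f a - f b - ⟪g b, a - b⟫)) + ⟪g b, a - b⟫ := by
  set e := f a - f b - ⟪g b, a - b⟫ with he
  have hD0 : 0 ≤ D := (norm_nonneg _).trans (hD a ha b hb)
  set p := ⟪g b - g a, u - a⟫ with hp
  have hid : ⟪g a, a - u⟫ - ⟪g b, b - u⟫ = p + ⟪g b, a - b⟫ := by
    simp only [hp, inner_sub_left, inner_sub_right]; ring
  rw [hid]
  have hpe : ∀ s ∈ Set.Icc (0 : ℝ) 1, s * p ≤ e + s ^ 2 * (L * D ^ 2 / 2) := by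
    intro s hs
    have hz := aux_mem hS ha hu hs
    have h1 := aux_descent hS hgrad hlip ha hz
    have h2 := aux_convex hconv hb hz (hgrad b hb)
    have h3 : ‖a + s • (u - a) - a‖ = s * ‖u - a‖ := by
      rw [add_sub_cancel_left, norm_smul, Real.norm_of_nonneg hs.1]
    rw [h3, add_sub_cancel_left, inner_smul_right] at h1
    rw [show a + s • (u - a) - b = (a - b) + s • (u - a) by abel, inner_add_right,
      inner_smul_right] at h2
    have h4 : ‖u - a‖ ^ 2 ≤ D ^ 2 := pow_le_pow_left₀ (norm_nonneg _) (hD u hu a ha) 2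
    have h5 : s ^ 2 * (L / 2) * ‖u - a‖ ^ 2 ≤ s ^ 2 * (L / 2) * D ^ 2 :=
      mul_le_mul_of_nonneg_left h4 (by positivity)
    rw [hp, inner_sub_left]
    nlinarith
  have hpL : p ≤ L * D ^ 2 := by
    have h1 : p ≤ ‖g b - g a‖ * ‖u - a‖ := real_inner_le_norm _ _
    have h2 : ‖g b - g a‖ ≤ L * D :=
      (hlip b hb a ha).trans (mul_le_mul_of_nonneg_left (hD b hb a ha) hL.le)
    have h3 := mul_le_mul h2 (hD u hu a ha) (norm_nonneg _) (by positivity)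
    nlinarith
  suffices p ≤ √(2 * L * D ^ 2 * e) by linarith
  rcases le_or_gt p 0 with h | h
  · exact h.trans (Real.sqrt_nonneg _)
  · apply Real.le_sqrt_of_sq_le
    have hpos : 0 < L * D ^ 2 := h.trans_le hpL
    have := hpe (p / (L * D ^ 2)) ⟨by positivity, (div_le_one hpos).2 hpL⟩
    have h6 : p / (L * D ^ 2) * p = p ^ 2 / (L * D ^ 2) := by ring
    have h7 : (p / (L * D ^ 2)) ^ 2 * (L * D ^ 2 / 2) = p ^ 2 / (L * D ^ 2) / 2 := by
      field_simp
    rw [h6, h7] at this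
    have h8 : p ^ 2 / (L * D ^ 2) ≤ 2 * e := by linarith
    rw [div_le_iff₀ hpos] at h8
    linarith

lemma aux_epoch {S : Set E} (hS : Convex ℝ S) {f : E → ℝ} {g : E → E} {L D : ℝ} (hL : 0 < L)
    (hD : ∀ a ∈ S, ∀ b ∈ S, ‖a - b‖ ≤ D) (hconv : ConvexOn ℝ S f)
    (hgrad : ∀ y ∈ S, HasGradientAt f (g y) y)
    (hlip : ∀ a ∈ S, ∀ b ∈ S, ‖g a - g b‖ ≤ L * ‖a - b‖) (M : ℕ) (v y : ℕ → E)
    (hSdef : S = convexHull ℝ (v '' Set.Icc 1 M)) (hy : ∀ i ≤ M, y i ∈ S)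
    (hr : ∀ i < M, 0 ≤ ⟪g (y (i + 1)), y i - y (i + 1)⟫)
    (hq : ∀ i < M, ⟪g (y (i + 1)), y (i + 1) - v (i + 1)⟫ ≤ 0)
    (xs : E) (hxs : xs ∈ S) (hmin : ∀ z ∈ S, f xs ≤ f z) :
    f (y M) ≤ f (y 0) ∧
    (f (y 0) - f xs) * (f (y M) - f xs) ≤ 4 * M * L * D ^ 2 * (f (y 0) - f (y M)) := by
  set r : ℕ → ℝ := fun i => ⟪g (y (i + 1)), y i - y (i + 1)⟫ with hrdef
  set e : ℕ → ℝ := fun i => f (y i) - f (y (i + 1)) - r i with hedef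
  have he0 : ∀ i < M, 0 ≤ e i := by
    intro i hi
    have := aux_convex hconv (hy (i + 1) hi) (hy i hi.le) (hgrad _ (hy (i + 1) hi))
    simp only [hedef, hrdef]; linarith
  have heD : ∀ i < M, e i ≤ L * D ^ 2 / 2 := by
    intro i hi
    have h1 := aux_descent hS hgrad hlip (hy (i + 1) hi) (hy i hi.le)
    have h4 : ‖y i - y (i + 1)‖ ^ 2 ≤ D ^ 2 :=
      pow_le_pow_left₀ (norm_nonneg _) (hD _ (hy i hi.le) _ (hy (i + 1) hi)) 2
    simp only [hedef, hrdef]; nlinarith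
  set B := ∑ i ∈ Finset.range M, (√(2 * L * D ^ 2 * e i) + r i) with hB
  have hvB : ∀ i < M, ⟪g (y 0), y 0 - v (i + 1)⟫ ≤ B := by
    intro i hi
    have hvS : v (i + 1) ∈ S := by
      rw [hSdef]
      exact subset_convexHull ℝ _ ⟨i + 1, ⟨by omega, by omega⟩, rfl⟩
    have h1 : ∑ j ∈ Finset.range (i + 1), (⟪g (y j), y j - v (i + 1)⟫ -
        ⟪g (y (j + 1)), y (j + 1) - v (i + 1)⟫) ≤
        ∑ j ∈ Finset.range (i + 1), (√(2 * L * D ^ 2 * e j) + r j) := by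
      apply Finset.sum_le_sum
      intro j hj
      have hj' : j < M := by have := Finset.mem_range.1 hj; omega
      exact aux_step hS hL hD hconv hgrad hlip (hy j hj'.le) (hy (j + 1) hj') hvS
    rw [Finset.sum_range_sub' (fun j => ⟪g (y j), y j - v (i + 1)⟫)] at h1
    have h2 : ∑ j ∈ Finset.range (i + 1), (√(2 * L * D ^ 2 * e j) + r j) ≤ B := by
      apply Finset.sum_le_sum_of_subset_of_nonneg
      · exact Finset.range_subset_range.2 hi
      · intro j hj _
        exact add_nonneg (Real.sqrt_nonneg _) (hr j (Finset.mem_range.1 hj))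
    have h3 := hq i hi
    linarith
  have hxB : ⟪g (y 0), y 0 - xs⟫ ≤ B := by
    have hconvB : Convex ℝ {u : E | ⟪g (y 0), y 0 - u⟫ ≤ B} := by
      intro a ha b hb s t hs ht hst
      simp only [Set.mem_ofPred_eq, inner_sub_right, inner_add_right, inner_smul_right] at *
      have h1 := mul_le_mul_of_nonneg_left ha hs
      have h2 := mul_le_mul_of_nonneg_left hb ht
      obtain rfl : t = 1 - s := by linarith
      nlinarith
    have hsub : convexHull ℝ (v '' Set.Icc 1 M) ⊆ {u : E | ⟪g (y 0), y 0 - u⟫ ≤ B} := by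
      apply convexHull_min _ hconvB
      rintro _ ⟨i, ⟨h1, h2⟩, rfl⟩
      obtain ⟨k, rfl⟩ := Nat.exists_eq_add_of_le' h1
      exact hvB k (by omega)
    rw [hSdef] at hxs
    exact hsub hxs
  have hh : f (y 0) - f xs ≤ B := by
    have := aux_convex hconv (hy 0 (Nat.zero_le _)) hxs (hgrad _ (hy 0 (Nat.zero_le _)))
    rw [← neg_sub (y 0) xs, inner_neg_right] at this
    linarith
  set R := ∑ i ∈ Finset.range M, r i with hR
  set T := ∑ i ∈ Finset.range M, e i with hT
  set Q := ∑ i ∈ Finset.range M, √(2 * L * D ^ 2 * e i) with hQ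
  have hBQ : B = Q + R := Finset.sum_add_distrib
  have hTR : T + R = f (y 0) - f (y M) := by
    rw [hT, hR, ← Finset.sum_add_distrib, ← Finset.sum_range_sub' (fun j => f (y j))]
    apply Finset.sum_congr rfl
    intro i _
    simp [hedef]
  have hR0 : 0 ≤ R := Finset.sum_nonneg fun i hi => hr i (Finset.mem_range.1 hi)
  have hT0 : 0 ≤ T := Finset.sum_nonneg fun i hi => he0 i (Finset.mem_range.1 hi)
  have hQ0 : 0 ≤ Q := Finset.sum_nonneg fun i hi => Real.sqrt_nonneg _
  have hTK : T ≤ M * (L * D ^ 2 / 2) := by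
    have := Finset.sum_le_card_nsmul (Finset.range M) e (L * D ^ 2 / 2)
      (fun i hi => heD i (Finset.mem_range.1 hi))
    simpa using this
  have hQ2 : Q ^ 2 ≤ (2 * M * L * D ^ 2) * T := by
    have h1 := sq_sum_le_card_mul_sum_sq (s := Finset.range M)
      (f := fun i => √(2 * L * D ^ 2 * e i))
    have h2 : ∑ i ∈ Finset.range M, √(2 * L * D ^ 2 * e i) ^ 2 = 2 * L * D ^ 2 * T := by
      rw [hT, Finset.mul_sum]
      apply Finset.sum_congr rfl
      intro i hi
      exact Real.sq_sqrt (mul_nonneg (by positivity) (he0 i (Finset.mem_range.1 hi)))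
    rw [h2, Finset.card_range] at h1
    linarith
  set K := 2 * (M : ℝ) * L * D ^ 2 with hK
  have hK0 : 0 ≤ K := by positivity
  have hQK : Q ≤ K := by
    apply le_of_sq_le_sq _ hK0
    nlinarith
  refine ⟨by linarith, ?_⟩
  have hm : 0 ≤ f (y M) - f xs := sub_nonneg.2 (hmin _ (hy M le_rfl))
  have h4 : 4 * (M : ℝ) * L * D ^ 2 = 2 * K := by rw [hK]; ring
  rw [h4, ← hTR]
  have h5 : f (y M) - f xs ≤ Q := by linarith
  have h6 : f (y 0) - f xs ≤ Q + R := by linarith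
  have h7 : (f (y 0) - f xs) * (f (y M) - f xs) ≤ (Q + R) * Q :=
    mul_le_mul h6 h5 hm (by linarith)
  have h8 : R * Q ≤ R * K := mul_le_mul_of_nonneg_left hQK hR0
  nlinarith [mul_nonneg hK0 hR0, mul_nonneg hK0 hT0]

end aux

theorem stmt12 {d : ℕ} (M : ℕ) (hM : 1 ≤ M)
    (v : ℕ → EuclideanSpace ℝ (Fin d))
    (S : Set (EuclideanSpace ℝ (Fin d)))
    (hSdef : S = convexHull ℝ (v '' Set.Icc 1 M))
    (D L : ℝ) (hL : 0 < L) (hD : ∀ a ∈ S, ∀ b ∈ S, ‖a - b‖ ≤ D)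
    (f : EuclideanSpace ℝ (Fin d) → ℝ)
    (g : EuclideanSpace ℝ (Fin d) → EuclideanSpace ℝ (Fin d))
    (hconv : ConvexOn ℝ S f)
    (hgrad : ∀ y ∈ S, HasGradientAt f (g y) y)
    (hlip : ∀ a ∈ S, ∀ b ∈ S, ‖g a - g b‖ ≤ L * ‖a - b‖)
    (xstar : EuclideanSpace ℝ (Fin d)) (hxs : xstar ∈ S)
    (hmin : ∀ y ∈ S, f xstar ≤ f y)
    (x : ℕ → ℕ → EuclideanSpace ℝ (Fin d)) (hx00 : x 0 0 ∈ S)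
    (α : ℕ → ℕ → ℝ)
    (hcycle : ∀ t, x (t + 1) 0 = x t M)
    (hstep : ∀ t, ∀ i, 1 ≤ i → i ≤ M →
      α t i ∈ Set.Icc (0 : ℝ) 1 ∧
      x t i = x t (i - 1) + α t i • (v i - x t (i - 1)) ∧
      ∀ β ∈ Set.Icc (0 : ℝ) 1,
        f (x t i) ≤ f (x t (i - 1) + β • (v i - x t (i - 1)))) :
    ∀ t : ℕ, 1 ≤ t →
      f (x t 0) - f xstar ≤
        max (f (x 1 0) - f xstar) (4 * M * L * D ^ 2) / (t : ℝ) := by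
  have hS : Convex ℝ S := by rw [hSdef]; exact convex_convexHull ℝ _
  have hvS : ∀ i, 1 ≤ i → i ≤ M → v i ∈ S := by
    intro i h1 h2
    rw [hSdef]
    exact subset_convexHull ℝ _ ⟨i, ⟨h1, h2⟩, rfl⟩
  have hin : ∀ t, x t 0 ∈ S → ∀ i ≤ M, x t i ∈ S := by
    intro t h0 i
    induction i with
    | zero => intro _; exact h0
    | succ k ih =>
      intro hk
      obtain ⟨h1, h2, _⟩ := hstep t (k + 1) (by omega) hk
      rw [h2]
      exact aux_mem hS (ih (by omega)) (hvS _ (by omega) hk) h1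
  have hx0 : ∀ t, x t 0 ∈ S := by
    intro t
    induction t with
    | zero => exact hx00
    | succ k ih => rw [hcycle]; exact hin k ih M le_rfl
  have hep : ∀ t, f (x (t + 1) 0) ≤ f (x t 0) ∧
      (f (x t 0) - f xstar) * (f (x (t + 1) 0) - f xstar) ≤
        4 * M * L * D ^ 2 * (f (x t 0) - f (x (t + 1) 0)) := by
    intro t
    rw [hcycle]
    have hy := hin t (hx0 t)
    refine aux_epoch hS hL hD hconv hgrad hlip M v (x t) hSdef hy ?_ ?_ xstar hxs hmin
    · intro i hi
      obtain ⟨h1, h2, h3⟩ := hstep t (i + 1) (by omega) hi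
      simp only [Nat.add_sub_cancel] at h2 h3
      apply aux_opt (hgrad _ (hy (i + 1) hi))
      intro s hs
      have h4 := h3 ((1 - s) * α t (i + 1))
        ⟨mul_nonneg (by linarith [hs.2]) h1.1,
          mul_le_one₀ (by linarith [hs.1]) h1.1 h1.2⟩
      refine h4.trans_eq ?_
      congr 1
      rw [h2]
      module
    · intro i hi
      obtain ⟨h1, h2, h3⟩ := hstep t (i + 1) (by omega) hi
      simp only [Nat.add_sub_cancel] at h2 h3
      have h5 : 0 ≤ ⟪g (x t (i + 1)), v (i + 1) - x t (i + 1)⟫ := by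
        apply aux_opt (hgrad _ (hy (i + 1) hi))
        intro s hs
        have h4 := h3 (α t (i + 1) + s * (1 - α t (i + 1)))
          ⟨by nlinarith [hs.1, h1.1, h1.2], by nlinarith [hs.2, h1.1, h1.2]⟩
        refine h4.trans_eq ?_
        congr 1
        rw [h2]
        module
      rw [← neg_sub, inner_neg_right] at h5
      linarith
  set A := max (f (x 1 0) - f xstar) (4 * M * L * D ^ 2) with hA
  have key : ∀ t : ℕ, 1 ≤ t → (f (x t 0) - f xstar) * t ≤ A := by
    intro t ht
    induction t, ht using Nat.le_induction with
    | base =>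
      rw [Nat.cast_one, mul_one]
      exact le_max_left _ _
    | succ t ht ih =>
      obtain ⟨h1, h2⟩ := hep t
      have hAC : 4 * M * L * D ^ 2 ≤ A := le_max_right _ _
      have h3 := mul_le_mul_of_nonneg_right hAC (sub_nonneg.2 h1)
      have h0 : 0 ≤ f (x (t + 1) 0) - f xstar := sub_nonneg.2 (hmin _ (hx0 _))
      have hA0 : 0 ≤ A := le_trans (by positivity) hAC
      rcases h0.eq_or_lt with h | h
      · rw [← h]; simpa using hA0
      · have hp : 0 < f (x t 0) - f xstar := by linarith
        refine le_of_mul_le_mul_right ?_ hp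
        have h4 := mul_le_mul_of_nonneg_right ih h0
        push_cast
        nlinarith
  intro t ht
  rw [le_div_iff₀ (by exact_mod_cast ht)]
  exact key t ht
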